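/- Let L be a frame. The following are equivalent: (1) every D-sublocale of L is T_D-spatial; (2) every S ∈ S_D(L) is a join in S(L) of elements of S_D(L) that are prime in S_D(L)^op (i.e. of sublocales P ∈ S_D(L), P ≠ {1}, such that P = S₁ ∨ S₂ with S₁, S₂ ∈ S_D(L) implies P = S₁ or P = S₂), that is, the frame S_D(L)^op is spatial; (3) every S ∈ S_D(L) is a join in S(L) of covered primes of S_D(L)^op, that is, the frame S_D(L)^op is T_D-spatial. -/

import Mathlib

open Set

universe u

namespace TD

variable {L : Type u} [Order.Frame L]

/-- A sublocale of a frame `L`: a subset closed under arbitrary meets and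
under `a ⇨ -` for every `a : L`. -/
def IsSublocale (S : Set L) : Prop :=
  (∀ A : Set L, A ⊆ S → sInf A ∈ S) ∧ ∀ a : L, ∀ s ∈ S, (a ⇨ s) ∈ S

/-- The covered primes of the (sub)frame `S` (meets computed in `L`,
which agree with meets in `S` when `S` is a sublocale).  The covered primes
of `L` itself are `ptD (Set.univ)`. -/
def ptD (S : Set L) : Set L :=
  {p | p ∈ S ∧ p ≠ ⊤ ∧ ∀ A : Set L, A ⊆ S → sInf A = p → p ∈ A}

/-- The primes of the (sub)frame `S`.  The primes of `L` itself are
`pt (Set.univ)`. -/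
def pt (S : Set L) : Set L :=
  {p | p ∈ S ∧ p ≠ ⊤ ∧ ∀ x ∈ S, ∀ y ∈ S, p = x ⊓ y → p = x ∨ p = y}

/-- A D-sublocale: a sublocale all of whose covered primes are covered primes
of the ambient frame `L`. -/
def IsDSublocale (S : Set L) : Prop :=
  IsSublocale S ∧ ptD S ⊆ ptD (univ : Set L)

/-- The join, computed in the coframe `S(L)` of all sublocales, of a family of
subsets of `L`: all meets of subsets of the union. -/
def sJoin (𝒮 : Set (Set L)) : Set L :=
  {x | ∃ A : Set L, A ⊆ ⋃₀ 𝒮 ∧ sInf A = x}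

/-- Binary join in `S(L)`. -/
def join2 (S T : Set L) : Set L := sJoin {S, T}

/-- The closed sublocale `c(a) = ↑a`. -/
def closedSub (a : L) : Set L := Ici a

/-- The open sublocale `o(a) = {a ⇨ b | b ∈ L}`. -/
def openSub (a : L) : Set L := {x | ∃ b : L, x = a ⇨ b}

/-- The Boolean sublocale `b(a) = {x ⇨ a | x ∈ L}`. -/
def bSub (a : L) : Set L := {x | ∃ y : L, x = y ⇨ a}

/-- A complemented sublocale: one having a complement in the coframe `S(L)`
(whose bottom is `{⊤}` and top is `L` itself, i.e. `Set.univ`). -/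
def IsComplementedSublocale (C : Set L) : Prop :=
  IsSublocale C ∧ ∃ C' : Set L, IsSublocale C' ∧ C ∩ C' = {⊤} ∧ join2 C C' = univ

/-- A smooth sublocale: a join in `S(L)` of complemented sublocales. -/
def IsSmooth (S : Set L) : Prop :=
  ∃ 𝒞 : Set (Set L), (∀ C ∈ 𝒞, IsComplementedSublocale C) ∧ S = sJoin 𝒞

/-- `M Y`: the closure of `Y` under arbitrary meets (with `⋀ ∅ = ⊤`). -/
def M (Y : Set L) : Set L := {x | ∃ A : Set L, A ⊆ Y ∧ sInf A = x}

/-- The (sub)frame `S` is `T_D`-spatial: every element of `S` is a meet of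
covered primes of `S`. -/
def IsTDSpatialSub (S : Set L) : Prop :=
  ∀ s ∈ S, ∃ P : Set L, P ⊆ ptD S ∧ sInf P = s

/-- The (sub)frame `S` is spatial: every element of `S` is a meet of primes
of `S`. -/
def IsSpatialSub (S : Set L) : Prop :=
  ∀ s ∈ S, ∃ P : Set L, P ⊆ pt S ∧ sInf P = s

/-- The primes of `L` lying above `a`, i.e. `pt(↑a)`. -/
def ptAbove (a : L) : Set L := {p | p ∈ pt (univ : Set L) ∧ a ≤ p}

/-- A prime of the frame `S_D(L)^op` (order-reversed coframe of D-sublocales):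
a D-sublocale `P ≠ {⊤}` such that `P = S₁ ∨ S₂` (join in `S(L)`) with
`S₁, S₂` D-sublocales implies `P = S₁` or `P = S₂`. -/
def PrimeInSDop (P : Set L) : Prop :=
  IsDSublocale P ∧ P ≠ ({⊤} : Set L) ∧
    ∀ S₁ S₂ : Set L, IsDSublocale S₁ → IsDSublocale S₂ →
      P = join2 S₁ S₂ → P = S₁ ∨ P = S₂

/-- A covered prime of the frame `S_D(L)^op`: a D-sublocale `P ≠ {⊤}` such
that whenever `P` is a join of a family of D-sublocales, it equals one of
them. -/
def CovPrimeInSDop (P : Set L) : Prop :=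
  IsDSublocale P ∧ P ≠ ({⊤} : Set L) ∧
    ∀ 𝒮 : Set (Set L), (∀ T ∈ 𝒮, IsDSublocale T) → P = sJoin 𝒮 → ∃ T ∈ 𝒮, P = T

/-- A prime of the frame `S(L)^op`. -/
def PrimeInSop (P : Set L) : Prop :=
  IsSublocale P ∧ P ≠ ({⊤} : Set L) ∧
    ∀ S₁ S₂ : Set L, IsSublocale S₁ → IsSublocale S₂ →
      P = join2 S₁ S₂ → P = S₁ ∨ P = S₂

/-- A prime of the frame `S_b(L)^op` of smooth sublocales. -/
def PrimeInSbop (P : Set L) : Prop :=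
  IsSmooth P ∧ P ≠ ({⊤} : Set L) ∧
    ∀ S₁ S₂ : Set L, IsSmooth S₁ → IsSmooth S₂ →
      P = join2 S₁ S₂ → P = S₁ ∨ P = S₂

/-- A prime element of a complete lattice. -/
def IsPrimeElt {α : Type*} [CompleteLattice α] (p : α) : Prop :=
  p ≠ ⊤ ∧ ∀ x y : α, p = x ⊓ y → p = x ∨ p = y

/-- A `T_D` topological space: `T₀` and every point has an open
neighbourhood `U` with `U \ {x}` open. -/
def IsTDSpace (X : Type*) [TopologicalSpace X] : Prop :=
  T0Space X ∧ ∀ x : X, ∃ U : Set X, IsOpen U ∧ x ∈ U ∧ IsOpen (U \ {x})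

/-- A sober space: every prime of the frame of opens is of the form
`X ∖ cl {x}` for a unique point `x`. -/
def IsSoberSpace (X : Type*) [TopologicalSpace X] : Prop :=
  ∀ p : TopologicalSpace.Opens X, IsPrimeElt p →
    ∃! x : X, p = ⟨(closure {x})ᶜ, isClosed_closure.isOpen_compl⟩


theorem IsSublocale.top_mem {S : Set L} (hS : IsSublocale S) : (⊤ : L) ∈ S := by
  simpa using hS.1 ∅ (empty_subset S)

theorem IsSublocale.sJoin_subset {S : Set L} (hS : IsSublocale S) {𝒮 : Set (Set L)}
    (h : ∀ T ∈ 𝒮, T ⊆ S) : sJoin 𝒮 ⊆ S := by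
  rintro x ⟨A, hA, rfl⟩
  exact hS.1 A (hA.trans (sUnion_subset h))

theorem subset_sJoin {𝒮 : Set (Set L)} {T : Set L} (hT : T ∈ 𝒮) : T ⊆ sJoin 𝒮 :=
  fun x hx => ⟨{x}, singleton_subset_iff.2 ⟨T, hT, hx⟩, sInf_singleton⟩

/-- A covered prime absorbs Heyting implications. -/
theorem himp_eq_of_mem_ptD {p : L} (hp : p ∈ ptD (univ : Set L)) (a : L) :
    a ⇨ p = p ∨ a ⇨ p = ⊤ := by
  have h : sInf {a ⇨ p, a ⊔ p} = p := by
    rw [sInf_pair]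
    refine le_antisymm ?_ (le_inf le_himp le_sup_right)
    rw [inf_sup_left]
    exact sup_le himp_inf_le inf_le_right
  rcases hp.2.2 _ (subset_univ _) h with h | h
  · exact Or.inl h.symm
  · exact Or.inr (himp_eq_top_iff.2 (sup_eq_right.1 h.symm))

theorem sInf_mem_pair {p : L} {A : Set L} (hA : A ⊆ {⊤, p}) :
    sInf A ∈ ({⊤, p} : Set L) := by
  by_cases h : p ∈ A
  · refine Or.inr (le_antisymm (sInf_le h) (le_sInf fun x hx => ?_))
    rcases hA hx with rfl | rfl
    exacts [le_top, le_rfl]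
  · refine Or.inl (sInf_eq_top.2 fun x hx => ?_)
    rcases hA hx with rfl | rfl
    exacts [rfl, (h hx).elim]

theorem isDSublocale_pair {p : L} (hp : p ∈ ptD (univ : Set L)) :
    IsDSublocale ({⊤, p} : Set L) := by
  refine ⟨⟨fun A hA => sInf_mem_pair hA, ?_⟩, ?_⟩
  · rintro a s (rfl | rfl)
    · exact Or.inl himp_top
    · exact (himp_eq_of_mem_ptD hp a).symm
  · rintro q ⟨rfl | rfl, hq, -⟩
    exacts [(hq rfl).elim, hp]

theorem covPrimeInSDop_pair {p : L} (hp : p ∈ ptD (univ : Set L)) :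
    CovPrimeInSDop ({⊤, p} : Set L) := by
  refine ⟨isDSublocale_pair hp, fun h => hp.2.1 ?_, fun 𝒮 h𝒮 hP => ?_⟩
  · exact h.subset (Or.inr rfl)
  · obtain ⟨A, hA, hAp⟩ : p ∈ sJoin 𝒮 := hP.subset (Or.inr rfl)
    obtain ⟨T, hT, hpT⟩ := hA (hp.2.2 A (subset_univ A) hAp)
    refine ⟨T, hT, Subset.antisymm ?_ (hP ▸ subset_sJoin hT)⟩
    rintro x (rfl | rfl)
    exacts [(h𝒮 T hT).1.top_mem, hpT]

theorem CovPrimeInSDop.primeInSDop {P : Set L} (hP : CovPrimeInSDop P) : PrimeInSDop P := by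
  refine ⟨hP.1, hP.2.1, fun S₁ S₂ h₁ h₂ h => ?_⟩
  obtain ⟨T, rfl | rfl, hT⟩ := hP.2.2 {S₁, S₂} (by rintro T (rfl | rfl) <;> assumption) h
  exacts [Or.inl hT, Or.inr hT]

/-- The intersection of a D-sublocale with a closed sublocale is a D-sublocale. -/
theorem IsDSublocale.inter_closedSub {P : Set L} (hP : IsDSublocale P) (a : L) :
    IsDSublocale (P ∩ closedSub a) := by
  refine ⟨⟨fun A hA => ⟨hP.1.1 A fun x hx => (hA hx).1, le_sInf fun x hx => (hA hx).2⟩,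
    fun c s hs => ⟨hP.1.2 c s hs.1, le_trans hs.2 le_himp⟩⟩, ?_⟩
  rintro p ⟨hp, hne, hcov⟩
  refine hP.2 ⟨hp.1, hne, fun A hA h => hcov A (fun x hx => ⟨hA hx, ?_⟩) h⟩
  exact le_trans hp.2 (h ▸ sInf_le hx)

theorem mem_openSub {a x : L} : x ∈ openSub a ↔ a ⇨ x = x :=
  ⟨by rintro ⟨b, rfl⟩; exact himp_idem, fun h => ⟨x, h.symm⟩⟩

theorem himp_sInf_eq (a : L) (A : Set L) : a ⇨ sInf A = sInf ((a ⇨ ·) '' A) := by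
  refine eq_of_forall_le_iff fun b => ?_
  simp [le_himp_iff, le_sInf_iff]

/-- The intersection of a D-sublocale with an open sublocale is a D-sublocale. -/
theorem IsDSublocale.inter_openSub {P : Set L} (hP : IsDSublocale P) (a : L) :
    IsDSublocale (P ∩ openSub a) := by
  refine ⟨⟨fun A hA => ⟨hP.1.1 A fun x hx => (hA hx).1, mem_openSub.2 ?_⟩,
    fun c s hs => ⟨hP.1.2 c s hs.1, mem_openSub.2 ?_⟩⟩, ?_⟩
  · rw [himp_sInf_eq, image_congr fun x hx => mem_openSub.1 (hA hx).2, image_id']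
  · rw [himp_left_comm, mem_openSub.1 hs.2]
  · rintro p ⟨hp, hne, hcov⟩
    refine hP.2 ⟨hp.1, hne, fun A hA h => ?_⟩
    have hmem : p ∈ (a ⇨ ·) '' A := by
      refine hcov _ ?_ (by rw [← himp_sInf_eq, h, mem_openSub.1 hp.2])
      rintro _ ⟨x, hx, rfl⟩
      exact ⟨hP.1.2 a x (hA hx), x, rfl⟩
    obtain ⟨x, hx, hxp⟩ := hmem
    have : x = p := le_antisymm (hxp ▸ le_himp) (h ▸ sInf_le hx)
    exact this ▸ hx

theorem IsSublocale.eq_join2_closedSub_openSub {P : Set L} (hP : IsSublocale P) (a : L) :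
    P = join2 (P ∩ closedSub a) (P ∩ openSub a) := by
  refine Subset.antisymm (fun x hx => ?_) (hP.sJoin_subset ?_)
  · have hax := hP.2 a x hx
    refine ⟨{(a ⇨ x) ⇨ x, a ⇨ x}, ?_, ?_⟩
    · rintro y (rfl | rfl)
      · exact ⟨_, Or.inl rfl, hP.2 _ x hx, le_himp_himp⟩
      · exact ⟨_, Or.inr rfl, hax, x, rfl⟩
    · rw [sInf_pair]
      exact le_antisymm himp_inf_le (le_inf le_himp le_himp)
  · rintro T (rfl | rfl) <;> exact inter_subset_left

/-- The primes of `S_D(L)^op` are the two-element sublocales given by covered primes. -/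
theorem PrimeInSDop.exists_eq_pair {P : Set L} (hP : PrimeInSDop P) :
    ∃ p ∈ ptD (univ : Set L), P = {⊤, p} := by
  obtain ⟨hD, hne, hprime⟩ := hP
  have hbot : sInf P ∈ P := hD.1.1 P Subset.rfl
  have heq : P = {⊤, sInf P} := by
    refine Subset.antisymm (fun x hx => ?_) ?_
    · rcases hprime _ _ (hD.inter_closedSub x) (hD.inter_openSub x)
        (hD.1.eq_join2_closedSub_openSub x) with h | h
      · exact Or.inr (le_antisymm (h.subset hbot).2 (sInf_le hx))
      · exact Or.inl ((mem_openSub.1 (h.subset hx).2).symm.trans himp_self)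
    · rintro x (rfl | rfl)
      exacts [hD.1.top_mem, hbot]
  have hbot_ne : sInf P ≠ ⊤ := fun h => hne (by rw [heq, h, pair_eq_singleton])
  refine ⟨sInf P, hD.2 ⟨hbot, hbot_ne, fun A hA h => ?_⟩, heq⟩
  by_contra hn
  refine hbot_ne (h.symm.trans (sInf_eq_top.2 fun x hx => ?_))
  rcases heq.subset (hA hx) with hx' | hx'
  · exact hx'
  · exact (hn ((show x = sInf P from hx') ▸ hx)).elim

theorem IsDSublocale.eq_sJoin_pairs {S : Set L} (hS : IsDSublocale S) (h : IsTDSpatialSub S) :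
    S = sJoin ((fun p => ({⊤, p} : Set L)) '' ptD S) := by
  refine Subset.antisymm (fun s hs => ?_) (hS.1.sJoin_subset ?_)
  · obtain ⟨A, hA, hAs⟩ := h s hs
    exact ⟨A, fun p hp => ⟨_, mem_image_of_mem _ (hA hp), Or.inr rfl⟩, hAs⟩
  · rintro _ ⟨p, hp, rfl⟩ x (rfl | rfl)
    exacts [hS.1.top_mem, hp.1]

theorem isTDSpatialSub_sJoin_of_primeInSDop {𝒮 : Set (Set L)}
    (h𝒮 : ∀ P ∈ 𝒮, PrimeInSDop P) : IsTDSpatialSub (sJoin 𝒮) := by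
  rintro s ⟨A, hA, rfl⟩
  refine ⟨A \ {⊤}, ?_, by simp⟩
  rintro x ⟨hx, hxt⟩
  obtain ⟨P, hP, hxP⟩ := hA hx
  obtain ⟨p, hp, hPp⟩ := (h𝒮 P hP).exists_eq_pair
  rcases hPp.subset hxP with h | rfl
  · exact (hxt h).elim
  · exact ⟨subset_sJoin hP hxP, hxt, fun B _ hB => hp.2.2 B (subset_univ B) hB⟩

/-- TFAE: (1) every D-sublocale of `L` is `T_D`-spatial;
(2) every D-sublocale is a join in `S(L)` of primes of `S_D(L)^op`
(`S_D(L)^op` is spatial); (3) every D-sublocale is a join in `S(L)` of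
covered primes of `S_D(L)^op` (`S_D(L)^op` is `T_D`-spatial). -/
theorem SDop_spatial_tfae (L : Type u) [Order.Frame L] :
    [∀ S : Set L, IsDSublocale S → IsTDSpatialSub S,
     ∀ S : Set L, IsDSublocale S →
       ∃ 𝒮 : Set (Set L), (∀ P ∈ 𝒮, PrimeInSDop P) ∧ S = sJoin 𝒮,
     ∀ S : Set L, IsDSublocale S →
       ∃ 𝒮 : Set (Set L), (∀ P ∈ 𝒮, CovPrimeInSDop P) ∧ S = sJoin 𝒮].TFAE := by
  tfae_have 1 → 3 := fun h S hS => by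
    refine ⟨_, ?_, hS.eq_sJoin_pairs (h S hS)⟩
    rintro _ ⟨p, hp, rfl⟩
    exact covPrimeInSDop_pair (hS.2 hp)
  tfae_have 3 → 2 := fun h S hS => by
    obtain ⟨𝒮, h𝒮, rfl⟩ := h S hS
    exact ⟨𝒮, fun P hP => (h𝒮 P hP).primeInSDop, rfl⟩
  tfae_have 2 → 1 := fun h S hS => by
    obtain ⟨𝒮, h𝒮, rfl⟩ := h S hS
    exact isTDSpatialSub_sJoin_of_primeInSDop h𝒮
  tfae_finish

end TD
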